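/- For any finite multisets of formulas Π and Σ, the weakening rule (from Γ ⇒ Δ infer Π,Γ ⇒ Δ,Σ) is strongly admissible in Go_∞+cut: there exists a non-expansive adequate mapping u : P → P such that u maps any ∞-proof of Γ ⇒ Δ to an ∞-proof of Π,Γ ⇒ Δ,Σ and |u(π)| ≤ |π| for every π ∈ P. -/

import Mathlib

inductive Formula : Type
  | atom : ℕ → Formula
  | bot  : Formula
  | imp  : Formula → Formula → Formula
  | box  : Formula → Formula
deriving DecidableEq

def boxtimes (Γ : Multiset Formula) : Multiset Formula := Γ + Γ.map Formula.box

inductive GoSeq : Bool → Multiset Formula → Multiset Formula → Prop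
  | ax (c) (Γ Δ : Multiset Formula) (A : Formula) : GoSeq c (A ::ₘ Γ) (A ::ₘ Δ)
  | axBot (c) (Γ Δ : Multiset Formula) : GoSeq c (Formula.bot ::ₘ Γ) Δ
  | impL (c) (Γ Δ : Multiset Formula) (A B : Formula) :
      GoSeq c (B ::ₘ Γ) Δ → GoSeq c Γ (A ::ₘ Δ) → GoSeq c ((A.imp B) ::ₘ Γ) Δ
  | impR (c) (Γ Δ : Multiset Formula) (A B : Formula) :
      GoSeq c (A ::ₘ Γ) (B ::ₘ Δ) → GoSeq c Γ ((A.imp B) ::ₘ Δ)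
  | boxGo (c) (Γ Δ Θ : Multiset Formula) (A : Formula) :
      GoSeq c ((Formula.box (A.imp (Formula.box A))) ::ₘ boxtimes Θ) {A} →
      GoSeq c (Γ + Θ.map Formula.box) ((Formula.box A) ::ₘ Δ)
  | cut (Γ Δ : Multiset Formula) (A : Formula) :
      GoSeq true Γ (A ::ₘ Δ) → GoSeq true (A ::ₘ Γ) Δ → GoSeq true Γ Δ

inductive Frag : Bool → ℕ → Multiset Formula → Multiset Formula → Type
  | hole (c) (Γ Δ : Multiset Formula) : Frag c 0 Γ Δ
  | axP (c) (n) (Γ Δ : Multiset Formula) (p : ℕ) :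
      Frag c (n+1) (Formula.atom p ::ₘ Γ) (Formula.atom p ::ₘ Δ)
  | axBot (c) (n) (Γ Δ : Multiset Formula) : Frag c (n+1) (Formula.bot ::ₘ Γ) Δ
  | impL (c) (n) (Γ Δ : Multiset Formula) (A B : Formula) :
      Frag c (n+1) (B ::ₘ Γ) Δ → Frag c (n+1) Γ (A ::ₘ Δ) →
      Frag c (n+1) ((A.imp B) ::ₘ Γ) Δ
  | impR (c) (n) (Γ Δ : Multiset Formula) (A B : Formula) :
      Frag c (n+1) (A ::ₘ Γ) (B ::ₘ Δ) → Frag c (n+1) Γ ((A.imp B) ::ₘ Δ)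
  | box (c) (n) (Γ Δ Θ : Multiset Formula) (l : List Formula) (h : l ≠ []) :
      Frag c (n+1) (boxtimes Θ) (boxtimes (↑l)) →
      ((i : Fin l.length) → Frag c n (boxtimes Θ) {l.get i}) →
      Frag c (n+1) (Γ + Θ.map Formula.box) ((↑(l.map Formula.box) : Multiset Formula) + Δ)
  | cut (n) (Γ Δ : Multiset Formula) (A : Formula) :
      Frag true (n+1) Γ (A ::ₘ Δ) → Frag true (n+1) (A ::ₘ Γ) Δ → Frag true (n+1) Γ Δ

def Frag.trunc : ∀ {c : Bool} {n : ℕ} {Γ Δ : Multiset Formula}, Frag c (n+1) Γ Δ → Frag c n Γ Δ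
  | c, 0, Γ, Δ, _ => .hole c Γ Δ
  | c, n+1, _, _, .axP _ _ Γ Δ p => .axP c n Γ Δ p
  | c, n+1, _, _, .axBot _ _ Γ Δ => .axBot c n Γ Δ
  | c, n+1, _, _, .impL _ _ Γ Δ A B a b => .impL c n Γ Δ A B a.trunc b.trunc
  | c, n+1, _, _, .impR _ _ Γ Δ A B a => .impR c n Γ Δ A B a.trunc
  | c, n+1, _, _, .box _ _ Γ Δ Θ l h a bs => .box c n Γ Δ Θ l h a.trunc (fun i => (bs i).trunc)
  | _, n+1, _, _, .cut _ Γ Δ A a b => .cut n Γ Δ A a.trunc b.trunc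

def Frag.height : ∀ {c : Bool} {n : ℕ} {Γ Δ : Multiset Formula}, Frag c n Γ Δ → ℕ
  | _, _, _, _, .hole _ _ _ => 0
  | _, _, _, _, .axP _ _ _ _ _ => 0
  | _, _, _, _, .axBot _ _ _ _ => 0
  | _, _, _, _, .impL _ _ _ _ _ _ a b => max a.height b.height + 1
  | _, _, _, _, .impR _ _ _ _ _ _ a => a.height + 1
  | _, _, _, _, .box _ _ _ _ _ _ _ a bs =>
      max a.height (Finset.univ.sup fun i => (bs i).height) + 1
  | _, _, _, _, .cut _ _ _ _ a b => max a.height b.height + 1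

def Frag.cutFree : ∀ {c : Bool} {n : ℕ} {Γ Δ : Multiset Formula}, Frag c n Γ Δ → Prop
  | _, _, _, _, .hole _ _ _ => True
  | _, _, _, _, .axP _ _ _ _ _ => True
  | _, _, _, _, .axBot _ _ _ _ => True
  | _, _, _, _, .impL _ _ _ _ _ _ a b => a.cutFree ∧ b.cutFree
  | _, _, _, _, .impR _ _ _ _ _ _ a => a.cutFree
  | _, _, _, _, .box _ _ _ _ _ _ _ a bs => a.cutFree ∧ ∀ i, (bs i).cutFree
  | _, _, _, _, .cut _ _ _ _ _ _ => False

structure InfProof (c : Bool) (Γ Δ : Multiset Formula) : Type where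
  frag : ∀ n : ℕ, Frag c n Γ Δ
  compat : ∀ n : ℕ, (frag (n+1)).trunc = frag n

structure PP : Type where
  Γ : Multiset Formula
  Δ : Multiset Formula
  prf : InfProof true Γ Δ

def Sim : ℕ → PP → PP → Prop
  | 0, _, _ => True
  | n+1, π, τ => π.Γ = τ.Γ ∧ π.Δ = τ.Δ ∧ HEq (π.prf.frag (n+1)) (τ.prf.frag (n+1))

noncomputable def dP (π τ : PP) : ℝ :=
  sInf {r : ℝ | ∃ n : ℕ, Sim n π τ ∧ r = (1/2 : ℝ) ^ n}

def localHeight (π : PP) : ℕ := (π.prf.frag 1).height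

def Pmem (n : ℕ) (π : PP) : Prop := (π.prf.frag n).cutFree

def IsUltrametric {M : Type*} (d : M → M → ℝ) : Prop :=
  (∀ x y, 0 ≤ d x y) ∧ (∀ x y, d x y = 0 ↔ x = y) ∧ (∀ x y, d x y = d y x) ∧
  (∀ x y z, d x z ≤ max (d x y) (d y z))

def cBall {M : Type*} (d : M → M → ℝ) (x : M) (r : ℝ) : Set M := {y | d x y ≤ r}

def SphericallyComplete {M : Type*} (d : M → M → ℝ) : Prop :=
  ∀ (c : ℕ → M) (r : ℕ → ℝ), (∀ n, 0 ≤ r n) →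
    (∀ n, cBall d (c (n+1)) (r (n+1)) ⊆ cBall d (c n) (r n)) →
    ∃ x, ∀ n, x ∈ cBall d (c n) (r n)

def NonExpansive1 (u : PP → PP) : Prop := ∀ π τ, dP (u π) (u τ) ≤ dP π τ

def Adequate1 (u : PP → PP) : Prop := ∀ n π, Pmem n π → Pmem n (u π)

noncomputable def dPm {m : ℕ} (x y : Fin m → PP) : ℝ := ⨆ i, dP (x i) (y i)

def NonExpansiveM {m : ℕ} (u : (Fin m → PP) → PP) : Prop :=
  ∀ x y, dP (u x) (u y) ≤ dPm x y

def Fm (m : ℕ) : Type := {u : (Fin m → PP) → PP // NonExpansiveM u}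

def SimF {m : ℕ} (n k : ℕ) (a b : (Fin m → PP) → PP) : Prop :=
  (∀ x, Sim n (a x) (b x)) ∧
  (∀ x, (∑ i, localHeight (x i)) < k → Sim (n+1) (a x) (b x))

noncomputable def lm {m : ℕ} (a b : (Fin m → PP) → PP) : ℝ :=
  (1/2) * sInf {r : ℝ | ∃ n k : ℕ, SimF n k a b ∧ r = (1/2 : ℝ) ^ n + (1/2 : ℝ) ^ (n + k)}

noncomputable def dP2 (p q : PP × PP) : ℝ := max (dP p.1 q.1) (dP p.2 q.2)

def NonExpansive2 (u : PP × PP → PP) : Prop := ∀ p q, dP (u p) (u q) ≤ dP2 p q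

def Adequate2 (u : PP × PP → PP) : Prop :=
  ∀ n π τ, Pmem n π → Pmem n τ → Pmem n (u (π, τ))

def Removing (A : Formula) (u : PP × PP → PP) : Prop :=
  ∀ (Γ Δ : Multiset Formula) (π τ : PP),
    π.Γ = Γ → π.Δ = A ::ₘ Δ → τ.Γ = A ::ₘ Γ → τ.Δ = Δ →
    (u (π, τ)).Γ = Γ ∧ (u (π, τ)).Δ = Δ

def RA (A : Formula) : Type := {u : PP × PP → PP // NonExpansive2 u ∧ Removing A u}

def SimF2 (n k : ℕ) (a b : PP × PP → PP) : Prop :=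
  (∀ p, Sim n (a p) (b p)) ∧
  (∀ p : PP × PP, localHeight p.1 + localHeight p.2 < k → Sim (n+1) (a p) (b p))

noncomputable def l2 (a b : PP × PP → PP) : ℝ :=
  (1/2) * sInf {r : ℝ | ∃ n k : ℕ, SimF2 n k a b ∧ r = (1/2 : ℝ) ^ n + (1/2 : ℝ) ^ (n + k)}

namespace Frag

/-- Transport a fragment along equalities of its end-sequent. -/
def copy {c : Bool} {n : ℕ} {Γ Δ Γ' Δ' : Multiset Formula} (hΓ : Γ = Γ') (hΔ : Δ = Δ')
    (f : Frag c n Γ Δ) : Frag c n Γ' Δ' :=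
  hΓ ▸ hΔ ▸ f

section copy

variable {c : Bool} {n : ℕ} {Γ Δ Γ' Δ' : Multiset Formula} (hΓ : Γ = Γ') (hΔ : Δ = Δ')

theorem trunc_copy (f : Frag c (n + 1) Γ Δ) : (f.copy hΓ hΔ).trunc = f.trunc.copy hΓ hΔ := by
  subst hΓ hΔ; rfl

theorem height_copy (f : Frag c n Γ Δ) : (f.copy hΓ hΔ).height = f.height := by
  subst hΓ hΔ; rfl

theorem cutFree_copy (f : Frag c n Γ Δ) : (f.copy hΓ hΔ).cutFree ↔ f.cutFree := by
  subst hΓ hΔ; rfl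

end copy

/-- Weakening of a fragment. The premises of the box rule are left unchanged, since the rule
already allows arbitrary contexts in its conclusion. -/
def weaken (Θ Ξ : Multiset Formula) :
    ∀ {c : Bool} {n : ℕ} {Γ Δ : Multiset Formula}, Frag c n Γ Δ → Frag c n (Θ + Γ) (Δ + Ξ)
  | _, _, _, _, .hole c _ _ => .hole c _ _
  | _, _, _, _, .axP c n Γ Δ p =>
      (Frag.axP c n (Θ + Γ) (Δ + Ξ) p).copy (Multiset.add_cons _ _ _).symm
        (Multiset.cons_add _ _ _).symm
  | _, _, _, _, .axBot c n Γ Δ =>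
      (Frag.axBot c n (Θ + Γ) (Δ + Ξ)).copy (Multiset.add_cons _ _ _).symm rfl
  | _, _, _, _, .impL c n Γ Δ A B a b =>
      (Frag.impL c n (Θ + Γ) (Δ + Ξ) A B
        ((a.weaken Θ Ξ).copy (Multiset.add_cons _ _ _) rfl)
        ((b.weaken Θ Ξ).copy rfl (Multiset.cons_add _ _ _))).copy
          (Multiset.add_cons _ _ _).symm rfl
  | _, _, _, _, .impR c n Γ Δ A B a =>
      (Frag.impR c n (Θ + Γ) (Δ + Ξ) A B
        ((a.weaken Θ Ξ).copy (Multiset.add_cons _ _ _) (Multiset.cons_add _ _ _))).copy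
          rfl (Multiset.cons_add _ _ _).symm
  | _, _, _, _, .box c n Γ Δ Λ l h a bs =>
      (Frag.box c n (Θ + Γ) (Δ + Ξ) Λ l h a bs).copy (add_assoc _ _ _) (add_assoc _ _ _).symm
  | _, _, _, _, .cut n Γ Δ A a b =>
      .cut n (Θ + Γ) (Δ + Ξ) A
        ((a.weaken Θ Ξ).copy rfl (Multiset.cons_add _ _ _))
        ((b.weaken Θ Ξ).copy (Multiset.add_cons _ _ _) rfl)

variable (Θ Ξ : Multiset Formula)

theorem trunc_weaken : ∀ {c : Bool} {n : ℕ} {Γ Δ : Multiset Formula} (f : Frag c (n + 1) Γ Δ),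
    (f.weaken Θ Ξ).trunc = f.trunc.weaken Θ Ξ
  | _, 0, _, _, _ => by simp [trunc, weaken]
  | _, _ + 1, _, _, .axP .. => by simp [trunc, weaken, trunc_copy]
  | _, _ + 1, _, _, .axBot .. => by simp [trunc, weaken, trunc_copy]
  | _, _ + 1, _, _, .impL _ _ _ _ _ _ a b => by
      simp [trunc, weaken, trunc_copy, trunc_weaken a, trunc_weaken b]
  | _, _ + 1, _, _, .impR _ _ _ _ _ _ a => by
      simp [trunc, weaken, trunc_copy, trunc_weaken a]
  | _, _ + 1, _, _, .box .. => by simp [trunc, weaken, trunc_copy]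
  | _, _ + 1, _, _, .cut _ _ _ _ a b => by
      simp [trunc, weaken, trunc_copy, trunc_weaken a, trunc_weaken b]

theorem height_weaken {c : Bool} {n : ℕ} {Γ Δ : Multiset Formula} (f : Frag c n Γ Δ) :
    (f.weaken Θ Ξ).height = f.height := by
  induction f <;> simp_all [weaken, height, height_copy]

theorem cutFree_weaken {c : Bool} {n : ℕ} {Γ Δ : Multiset Formula} (f : Frag c n Γ Δ) :
    (f.weaken Θ Ξ).cutFree ↔ f.cutFree := by
  induction f <;> simp_all [weaken, cutFree, cutFree_copy]

end Frag

/-- Weakening of an ∞-proof. -/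
def PP.weaken (Θ Ξ : Multiset Formula) (π : PP) : PP where
  Γ := Θ + π.Γ
  Δ := π.Δ + Ξ
  prf :=
    { frag := fun n => (π.prf.frag n).weaken Θ Ξ
      compat := fun n => by rw [Frag.trunc_weaken, π.prf.compat] }

theorem Sim.weaken (Θ Ξ : Multiset Formula) {n : ℕ} {π τ : PP} (h : Sim n π τ) :
    Sim n (π.weaken Θ Ξ) (τ.weaken Θ Ξ) := by
  cases n with
  | zero => trivial
  | succ n =>
    obtain ⟨Γ, Δ, p⟩ := π
    obtain ⟨Γ', Δ', q⟩ := τ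
    obtain ⟨hΓ, hΔ, hf⟩ := h
    dsimp only at hΓ hΔ hf
    subst hΓ hΔ
    exact ⟨rfl, rfl, heq_of_eq (congrArg (Frag.weaken Θ Ξ) (eq_of_heq hf))⟩

theorem nonExpansive1_of_sim {u : PP → PP} (h : ∀ n π τ, Sim n π τ → Sim n (u π) (u τ)) :
    NonExpansive1 u := by
  refine fun π τ => csInf_le_csInf ⟨0, ?_⟩ ⟨_, 0, trivial, rfl⟩ ?_
  · rintro _ ⟨n, -, rfl⟩
    positivity
  · rintro _ ⟨n, hn, rfl⟩
    exact ⟨n, h n π τ hn, rfl⟩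

theorem stmt13 (Θ Ξ : Multiset Formula) :
    ∃ u : PP → PP, NonExpansive1 u ∧ Adequate1 u ∧
      (∀ π : PP, (u π).Γ = Θ + π.Γ ∧ (u π).Δ = π.Δ + Ξ) ∧
      (∀ π : PP, localHeight (u π) ≤ localHeight π) := by
  exact ⟨PP.weaken Θ Ξ, nonExpansive1_of_sim fun _ _ _ => Sim.weaken Θ Ξ,
    fun n π => (Frag.cutFree_weaken Θ Ξ (π.prf.frag n)).mpr, fun _ => ⟨rfl, rfl⟩,
    fun π => (Frag.height_weaken Θ Ξ (π.prf.frag 1)).le⟩
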